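/- arXiv:2002.12260 — 2 statements merged into one kernel-verified Lean document; each statement's English description precedes it below -/
import Mathlib

section
/- Let 2<p<∞, let ζ ∈ L¹(Π) ∩ L^p(Π) be nonnegative and nontrivial with I(ζ) < ∞, and for τ > 0 define the upward translate ζ_τ(x₁,x₂) := ζ(x₁, x₂ − τ) for x₂ > τ and ζ_τ(x₁,x₂) := 0 for 0 < x₂ ≤ τ. Then E(ζ_τ) > E(ζ), i.e. translating ζ in the positive x₂-direction strictly increases the kinetic energy. -/
open MeasureTheory Real Filter Topology

noncomputable section

/-- The open upper half-plane Π. -/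
def UHP : Set (ℝ × ℝ) := {x | 0 < x.2}

/-- Planar Lebesgue measure restricted to the upper half-plane. -/
def μUH : Measure (ℝ × ℝ) := MeasureTheory.volume.restrict UHP

/-- Squared Euclidean distance in the plane. -/
def sqdist (x y : ℝ × ℝ) : ℝ := (x.1 - y.1) ^ 2 + (x.2 - y.2) ^ 2

/-- Euclidean distance in the plane. -/
def euclDist (x y : ℝ × ℝ) : ℝ := Real.sqrt (sqdist x y)

/-- The Green's function of −Δ in the upper half-plane:
`G(x,y) = (1/(4π)) log(1 + 4 x₂ y₂ / |x−y|²)`. -/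
def greenG (x y : ℝ × ℝ) : ℝ :=
  (4 * π)⁻¹ * Real.log (1 + 4 * x.2 * y.2 / sqdist x y)

/-- The stream-function operator `𝒢ζ(x) = ∫_Π G(x,y) ζ(y) dy`. -/
def Gop (ζ : ℝ × ℝ → ℝ) (x : ℝ × ℝ) : ℝ := ∫ y, greenG x y * ζ y ∂μUH

/-- Kinetic energy `E(ζ) = (1/2) ∫_Π ζ 𝒢ζ`. -/
def energy (ζ : ℝ × ℝ → ℝ) : ℝ := (1 / 2) * ∫ x, ζ x * Gop ζ x ∂μUH

/-- Impulse `I(ζ) = ∫_Π ζ(y) y₂ dy`. -/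
def impulse (ζ : ℝ × ℝ → ℝ) : ℝ := ∫ y, ζ y * y.2 ∂μUH

/-- The `L^p(Π)` norm, as a real number. -/
def lpN (p : ℝ) (ζ : ℝ × ℝ → ℝ) : ℝ := (eLpNorm ζ (ENNReal.ofReal p) μUH).toReal

/-- `f ⪯ g` : `∫ (f−a)₊ ≤ ∫ (g−a)₊` for every `a > 0`. -/
def prec (f g : ℝ × ℝ → ℝ) : Prop :=
  ∀ a : ℝ, 0 < a → ∫ x, max (f x - a) 0 ∂μUH ≤ ∫ x, max (g x - a) 0 ∂μUH

/-- `f` is a rearrangement of `g` on Π. -/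
def IsRearr (f g : ℝ × ℝ → ℝ) : Prop :=
  ∀ a : ℝ, 0 < a → μUH {x | a < f x} = μUH {x | a < g x}

/-- Membership of the relaxed constraint class `𝒲(ζ₀)`. -/
def memW (ζ₀ ζ : ℝ × ℝ → ℝ) : Prop :=
  (∀ x, 0 ≤ ζ x) ∧ Integrable ζ μUH ∧ prec ζ ζ₀

/-- `𝒲(ζ₀, ≤ i₀)`. -/
def Wle (ζ₀ : ℝ × ℝ → ℝ) (i₀ : ℝ) : Set (ℝ × ℝ → ℝ) :=
  {ζ | memW ζ₀ ζ ∧ impulse ζ ≤ i₀}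

/-- `𝒲(ζ₀, i₀)`. -/
def Weq (ζ₀ : ℝ × ℝ → ℝ) (i₀ : ℝ) : Set (ℝ × ℝ → ℝ) :=
  {ζ | memW ζ₀ ζ ∧ impulse ζ = i₀}

/-- Membership of `ℛ⁺(ζ₀)`: restrictions of rearrangements of `ζ₀`. -/
def memRplus (ζ₀ ζ : ℝ × ℝ → ℝ) : Prop :=
  ∃ ξ : ℝ × ℝ → ℝ, ∃ A : Set (ℝ × ℝ), IsRearr ξ ζ₀ ∧ MeasurableSet A ∧
    ζ = A.indicator ξ

/-- Steiner symmetry about the `x₂`-axis. -/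
def SteinerSym (ζ : ℝ × ℝ → ℝ) : Prop :=
  ∀ᵐ t ∂(MeasureTheory.volume.restrict (Set.Ioi (0 : ℝ))),
    (∀ s : ℝ, ζ (-s, t) = ζ (s, t)) ∧
    (∀ s₁ s₂ : ℝ, 0 ≤ s₁ → s₁ ≤ s₂ → ζ (s₂, t) ≤ ζ (s₁, t))

/-- The decreasing rearrangement `ζ^Δ(s) = inf {a > 0 : |{ζ > a}| ≤ s}`. -/
def decRearr (ζ : ℝ × ℝ → ℝ) (s : ℝ) : ℝ :=
  sInf {a : ℝ | 0 < a ∧ μUH {x | a < ζ x} ≤ ENNReal.ofReal s}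

/-- The norm `‖ζ‖_{𝔛^p} = |I(ζ)| + ‖ζ‖₁ + ‖ζ‖_p`. -/
def XpNorm (p : ℝ) (ζ : ℝ × ℝ → ℝ) : ℝ := |impulse ζ| + lpN 1 ζ + lpN p ζ

/-- Distance to a set of functions in the `𝔛^p` norm. -/
def XpDist (p : ℝ) (ζ : ℝ × ℝ → ℝ) (S : Set (ℝ × ℝ → ℝ)) : ℝ :=
  sInf ((fun σ => XpNorm p fun x => ζ x - σ x) '' S)


theorem aux_log (A B s : ℝ) (hA : 0 ≤ A) (hB : 0 ≤ B) (hs : 0 ≤ s) :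
    Real.log (1 + 4 * A * B / s) ≤ 2 * A + 2 * B + Real.log (1 + 1 / s) := by
  have hi : 0 ≤ 1 / s := by positivity
  have h1 : 1 + 4 * A * B / s ≤ ((1 + 2 * A) * (1 + 2 * B)) * (1 + 1 / s) := by
    have : 4 * A * B / s = 4 * A * B * (1 / s) := by ring
    rw [this]
    have hAB := mul_nonneg hA hB
    nlinarith [mul_nonneg hA hi, mul_nonneg hB hi]
  have h0 : 0 < 1 + 4 * A * B / s := by positivity
  calc _ ≤ Real.log (((1 + 2 * A) * (1 + 2 * B)) * (1 + 1 / s)) := Real.log_le_log h0 h1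
    _ = Real.log (1 + 2 * A) + Real.log (1 + 2 * B) + Real.log (1 + 1 / s) := by
      rw [Real.log_mul (by positivity) (by positivity), Real.log_mul (by positivity) (by positivity)]
    _ ≤ _ := by
      have := Real.log_le_sub_one_of_pos (show 0 < 1 + 2 * A by positivity)
      have := Real.log_le_sub_one_of_pos (show 0 < 1 + 2 * B by positivity)
      linarith

/-- one-dimensional majorant -/
def auxF (a : ℝ) : ℝ := (Set.Ioc (-1 : ℝ) 1).indicator (fun a => |a| ^ (-(1/2) : ℝ)) a

theorem auxF_int : Integrable auxF := by
  unfold auxF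
  rw [integrable_indicator_iff measurableSet_Ioc]
  have h := intervalIntegral.intervalIntegrable_rpow' (a := 0) (b := 1)
    (r := (-(1/2) : ℝ)) (by norm_num)
  have hp : IntegrableOn (fun a : ℝ => |a| ^ (-(1/2) : ℝ)) (Set.Ioc 0 1) := by
    rw [intervalIntegrable_iff_integrableOn_Ioc_of_le (by norm_num)] at h
    refine h.congr_fun (fun x hx => ?_) measurableSet_Ioc
    simp only [abs_of_pos hx.1]
  have hn : IntegrableOn (fun a : ℝ => |a| ^ (-(1/2) : ℝ)) (Set.Ioc (-1) 0) := by
    have h2 := (intervalIntegrable_iff_integrableOn_Ioc_of_le (μ := volume) (by norm_num)).2 hp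
    have h3 := ((IntervalIntegrable.iff_comp_neg (by simp)).1 h2).symm
    simp only [abs_neg, neg_zero] at h3
    exact (intervalIntegrable_iff_integrableOn_Ioc_of_le (by norm_num)).1 h3
  have := hn.union hp
  rwa [Set.Ioc_union_Ioc_eq_Ioc (by norm_num) (by norm_num)] at this

/-- log kernel as a function of the difference -/
def auxL (d : ℝ × ℝ) : ℝ := Real.log (1 + 1 / (d.1 ^ 2 + d.2 ^ 2))

/-- box -/
def auxBox : Set (ℝ × ℝ) := Set.Ioc (-1 : ℝ) 1 ×ˢ Set.Ioc (-1 : ℝ) 1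

theorem auxL_nonneg (d : ℝ × ℝ) : 0 ≤ auxL d := by
  apply Real.log_nonneg
  have : 0 ≤ 1 / (d.1 ^ 2 + d.2 ^ 2) := by positivity
  linarith

theorem auxL_meas : Measurable auxL := by
  unfold auxL
  fun_prop

theorem auxBox_meas : MeasurableSet auxBox := measurableSet_Ioc.prod measurableSet_Ioc

/-- squared local kernel -/
def auxK (d : ℝ × ℝ) : ℝ := auxBox.indicator (fun d => auxL d ^ 2) d

theorem auxL_out (d : ℝ × ℝ) (h : d ∉ auxBox) : auxL d ≤ 1 := by
  have h1 : 1 ≤ d.1 ^ 2 + d.2 ^ 2 := by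
    by_contra hc
    push Not at hc
    apply h
    refine ⟨⟨?_, ?_⟩, ⟨?_, ?_⟩⟩ <;> nlinarith [sq_nonneg d.1, sq_nonneg d.2]
  have h2 : 1 / (d.1 ^ 2 + d.2 ^ 2) ≤ 1 := by
    rw [div_le_one (by linarith)]; exact h1
  have h3 : 0 ≤ 1 / (d.1 ^ 2 + d.2 ^ 2) := by positivity
  have := Real.log_le_sub_one_of_pos (show 0 < 1 + 1 / (d.1 ^ 2 + d.2 ^ 2) by linarith)
  unfold auxL; linarith

theorem auxL_in (d : ℝ × ℝ) (h : d ∈ auxBox) (ha : d.1 ≠ 0) (hb : d.2 ≠ 0) :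
    auxL d ^ 2 ≤ 32 * (auxF d.1 * auxF d.2) := by
  obtain ⟨a, b⟩ := d
  simp only [auxBox, Set.mem_prod] at h ha hb
  have hF : auxF a * auxF b = (|a| * |b|) ^ (-(1/2) : ℝ) := by
    simp only [auxF, Set.indicator_of_mem h.1, Set.indicator_of_mem h.2]
    rw [Real.mul_rpow (abs_nonneg _) (abs_nonneg _)]
  have hpa := abs_pos.2 ha
  have hpb := abs_pos.2 hb
  have ha1 : |a| ≤ 1 := abs_le.2 ⟨h.1.1.le, h.1.2⟩
  have hb1 : |b| ≤ 1 := abs_le.2 ⟨h.2.1.le, h.2.2⟩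
  set m := |a| * |b| with hm
  have hmp : 0 < m := by positivity
  have hm1 : m ≤ 1 := mul_le_one₀ ha1 hpb.le hb1
  have hr : m ≤ a ^ 2 + b ^ 2 := by
    rw [← sq_abs a, ← sq_abs b]; nlinarith [sq_nonneg (|a| - |b|)]
  have h1 : auxL (a, b) ≤ Real.log (2 / m) := by
    unfold auxL
    apply Real.log_le_log (by positivity)
    have : 1 / (a ^ 2 + b ^ 2) ≤ 1 / m := one_div_le_one_div_of_le hmp hr
    have h1m : 1 ≤ 1 / m := by rw [le_div_iff₀ hmp]; linarith
    have : 2 / m = 1 / m + 1 / m := by ring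
    simp only
    linarith
  have h2 := Real.log_le_rpow_div (show 0 ≤ 2 / m by positivity) (show (0:ℝ) < 1/4 by norm_num)
  have h3 : auxL (a, b) ≤ 4 * (2 / m) ^ (1/4 : ℝ) := by linarith
  have h4 : auxL (a, b) ^ 2 ≤ (4 * (2 / m) ^ (1/4 : ℝ)) ^ 2 :=
    pow_le_pow_left₀ (auxL_nonneg _) h3 2
  have h5 : (4 * (2 / m) ^ (1/4 : ℝ)) ^ 2 = 16 * (2 ^ (1/2 : ℝ) * m ^ (-(1/2) : ℝ)) := by
    rw [mul_pow, ← Real.rpow_natCast ((2 / m) ^ (1/4 : ℝ)), ← Real.rpow_mul (by positivity),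
      Real.div_rpow (by norm_num) hmp.le, Real.rpow_neg hmp.le]
    norm_num
    rfl
  have h6 : (2:ℝ) ^ (1/2 : ℝ) ≤ 2 := by
    calc (2:ℝ) ^ (1/2 : ℝ) ≤ 2 ^ (1:ℝ) := Real.rpow_le_rpow_of_exponent_le (by norm_num) (by norm_num)
      _ = 2 := by simp
  have h7 : 0 ≤ m ^ (-(1/2) : ℝ) := by positivity
  simp only [hF]
  nlinarith

theorem auxK_int : Integrable auxK := by
  have hF : Integrable (fun d : ℝ × ℝ => 32 * (auxF d.1 * auxF d.2)) :=
    (auxF_int.mul_prod auxF_int).const_mul 32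
  refine hF.mono' ?_ ?_
  · exact ((auxL_meas.pow_const 2).indicator auxBox_meas).aestronglyMeasurable
  · have ha : ∀ᵐ d : ℝ × ℝ, d.1 ≠ 0 :=
      Measure.quasiMeasurePreserving_fst.ae (p := fun a : ℝ => a ≠ 0) (Measure.ae_ne volume 0)
    have hb : ∀ᵐ d : ℝ × ℝ, d.2 ≠ 0 :=
      Measure.quasiMeasurePreserving_snd.ae (p := fun a : ℝ => a ≠ 0) (Measure.ae_ne volume 0)
    filter_upwards [ha, hb] with d h1 h2
    unfold auxK
    by_cases h : d ∈ auxBox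
    · rw [Set.indicator_of_mem h, Real.norm_of_nonneg (sq_nonneg _)]
      exact auxL_in d h h1 h2
    · rw [Set.indicator_of_notMem h, norm_zero]
      have : ∀ a, 0 ≤ auxF a := fun a => Set.indicator_nonneg (fun x _ => by positivity) _
      have := mul_nonneg (this d.1) (this d.2)
      linarith

theorem auxLK (d : ℝ × ℝ) (z : ℝ) (hz : 0 ≤ z) : auxL d * z ≤ z + z ^ 2 + auxK d := by
  unfold auxK
  by_cases h : d ∈ auxBox
  · rw [Set.indicator_of_mem h]
    nlinarith [sq_nonneg (auxL d - z), sq_nonneg (auxL d), sq_nonneg z]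
  · rw [Set.indicator_of_notMem h]
    nlinarith [auxL_out d h, sq_nonneg z]

/-- translated kernel -/
def auxG (t : ℝ) (x y : ℝ × ℝ) : ℝ :=
  (4 * π)⁻¹ * Real.log (1 + 4 * (x.2 + t) * (y.2 + t) / sqdist x y)

theorem auxG_meas (t : ℝ) : Measurable (fun q : (ℝ × ℝ) × (ℝ × ℝ) => auxG t q.1 q.2) := by
  unfold auxG sqdist
  fun_prop

theorem aux_int (η : ℝ × ℝ → ℝ) (hn : ∀ x, 0 ≤ η x) (h0 : ∀ x, x.2 ≤ 0 → η x = 0)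
    (h1 : Integrable η) (h2 : Integrable (fun x => η x ^ 2))
    (h3 : Integrable (fun x => η x * x.2)) (t : ℝ) (ht : 0 ≤ t) :
    Integrable (fun q : (ℝ × ℝ) × (ℝ × ℝ) => η q.1 * (auxG t q.1 q.2 * η q.2))
      (volume.prod volume) := by
  have i1 := (h1.mul_prod h1).const_mul (1 + 4 * t)
  have i2 := (h3.mul_prod h1).const_mul 2
  have i3 := (h1.mul_prod h3).const_mul 2
  have i4 := h1.mul_prod h2
  have i5 : Integrable (fun q : (ℝ × ℝ) × (ℝ × ℝ) => η q.1 * auxK (q.2 - q.1))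
      (volume.prod volume) := by
    have := (h1.convolution_integrand (ContinuousLinearMap.mul ℝ ℝ) auxK_int).swap
    simpa [Function.comp_def] using this
  have hs := ((((i1.add i2).add i3).add i4).add i5).const_mul ((4 * π)⁻¹)
  refine hs.mono' ?_ (Eventually.of_forall ?_)
  · have m1 : AEStronglyMeasurable (fun q : (ℝ × ℝ) × (ℝ × ℝ) => η q.1) (volume.prod volume) :=
      h1.aestronglyMeasurable.comp_fst
    have m2 : AEStronglyMeasurable (fun q : (ℝ × ℝ) × (ℝ × ℝ) => η q.2) (volume.prod volume) :=
      h1.aestronglyMeasurable.comp_snd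
    exact m1.mul ((auxG_meas t).aestronglyMeasurable.mul m2)
  · rintro ⟨x, y⟩
    simp only [Pi.add_apply]
    have hpi : 0 < (4 * π)⁻¹ := by positivity
    by_cases hx : x.2 ≤ 0
    · have hK : 0 ≤ auxK (y - x) := Set.indicator_nonneg (fun _ _ => sq_nonneg _) _
      simp [h0 x hx]
    by_cases hy : y.2 ≤ 0
    · have hK : 0 ≤ auxK (y - x) := Set.indicator_nonneg (fun _ _ => sq_nonneg _) _
      have := mul_nonneg (hn x) hK
      simp [h0 y hy]
      positivity
    push Not at hx hy
    have hsq : 0 ≤ sqdist x y := by unfold sqdist; positivity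
    have hlog := aux_log (x.2 + t) (y.2 + t) (sqdist x y) (by linarith) (by linarith) hsq
    have hL : Real.log (1 + 1 / sqdist x y) = auxL (y - x) := by
      unfold auxL sqdist
      congr 3
      simp only [Prod.fst_sub, Prod.snd_sub]
      ring
    rw [hL] at hlog
    have hln : 0 ≤ Real.log (1 + 4 * (x.2 + t) * (y.2 + t) / sqdist x y) := by
      apply Real.log_nonneg
      have : 0 ≤ 4 * (x.2 + t) * (y.2 + t) / sqdist x y := by positivity
      linarith
    have hG : 0 ≤ auxG t x y := mul_nonneg hpi.le hln
    rw [Real.norm_of_nonneg (mul_nonneg (hn x) (mul_nonneg hG (hn y)))]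
    unfold auxG
    have e : ∀ l : ℝ, η x * ((4 * π)⁻¹ * l * η y) = (4 * π)⁻¹ * (η x * (l * η y)) := by
      intro l; ring
    rw [e]
    refine mul_le_mul_of_nonneg_left ?_ hpi.le
    have hk := auxLK (y - x) (η y) (hn y)
    have hA : Real.log (1 + 4 * (x.2 + t) * (y.2 + t) / sqdist x y) * η y
        ≤ (2 * (x.2 + t) + 2 * (y.2 + t)) * η y + (η y + η y ^ 2 + auxK (y - x)) := by
      have := mul_le_mul_of_nonneg_right hlog (hn y)
      linarith
    have := mul_le_mul_of_nonneg_left hA (hn x)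
    linarith

theorem aux_lt (η : ℝ × ℝ → ℝ) (hn : ∀ x, 0 ≤ η x) (h0 : ∀ x, x.2 ≤ 0 → η x = 0)
    (h1 : Integrable η) (h2 : Integrable (fun x => η x ^ 2))
    (h3 : Integrable (fun x => η x * x.2)) (hne : ¬ (∀ᵐ x, η x = 0)) (t : ℝ) (ht : 0 < t) :
    ∫ x, η x * ∫ y, auxG 0 x y * η y < ∫ x, η x * ∫ y, auxG t x y * η y := by
  have j0 := aux_int η hn h0 h1 h2 h3 0 le_rfl
  have jt := aux_int η hn h0 h1 h2 h3 t ht.le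
  simp only [← integral_const_mul]
  rw [← integral_prod _ j0, ← integral_prod _ jt, ← sub_pos, ← integral_sub jt j0]
  have hlt : ∀ x y : ℝ × ℝ, 0 < x.2 → 0 < y.2 → x ≠ y → auxG 0 x y < auxG t x y := by
    intro x y hx hy hxy
    have hs : 0 < sqdist x y := by
      unfold sqdist
      rcases (not_and_or.1 (fun h => hxy (Prod.ext_iff.2 h))) with h | h
      · have := sub_ne_zero.2 h; positivity
      · have := sub_ne_zero.2 h; positivity
    unfold auxG
    apply mul_lt_mul_of_pos_left _ (by positivity)
    apply Real.log_lt_log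
    · simp only [add_zero]; positivity
    · have : 4 * (x.2 + 0) * (y.2 + 0) < 4 * (x.2 + t) * (y.2 + t) := by nlinarith
      have := div_lt_div_of_pos_right this hs
      linarith
  have heq : ∀ x : ℝ × ℝ, auxG 0 x x ≤ auxG t x x := by
    intro x; simp [auxG, sqdist]
  have hle : ∀ q : (ℝ × ℝ) × (ℝ × ℝ),
      0 ≤ η q.1 * (auxG t q.1 q.2 * η q.2) - η q.1 * (auxG 0 q.1 q.2 * η q.2) := by
    rintro ⟨x, y⟩
    simp only
    by_cases hx : x.2 ≤ 0
    · simp [h0 x hx]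
    by_cases hy : y.2 ≤ 0
    · simp [h0 y hy]
    push Not at hx hy
    have : auxG 0 x y ≤ auxG t x y := by
      by_cases h : x = y
      · subst h; exact heq x
      · exact (hlt x y hx hy h).le
    rw [sub_nonneg]
    exact mul_le_mul_of_nonneg_left (mul_le_mul_of_nonneg_right this (hn y)) (hn x)
  refine lt_of_le_of_ne (integral_nonneg hle) ?_
  intro hz
  have hz' := (integral_eq_zero_iff_of_nonneg hle (jt.sub j0)).1 hz.symm
  have hae := Measure.ae_ae_of_ae_prod hz'
  apply hne
  filter_upwards [hae] with x hx
  by_contra hxne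
  apply hne
  filter_upwards [hx, Measure.ae_ne volume x] with y hy hyx
  by_contra hyne
  have hxp : 0 < η x := lt_of_le_of_ne (hn x) (Ne.symm hxne)
  have hyp : 0 < η y := lt_of_le_of_ne (hn y) (Ne.symm hyne)
  have hx2 : 0 < x.2 := by by_contra hc; exact hxne (h0 x (not_lt.1 hc))
  have hy2 : 0 < y.2 := by by_contra hc; exact hyne (h0 y (not_lt.1 hc))
  have := hlt x y hx2 hy2 (Ne.symm hyx)
  have := mul_lt_mul_of_pos_left (mul_lt_mul_of_pos_right this hyp) hxp
  simp only [Pi.zero_apply] at hy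
  linarith

theorem UHP_meas : MeasurableSet UHP := measurableSet_lt measurable_const measurable_snd

theorem aux_energy (ζ : ℝ × ℝ → ℝ) :
    energy ζ = (1/2) * ∫ x, UHP.indicator ζ x * ∫ y, greenG x y * UHP.indicator ζ y := by
  unfold energy Gop μUH
  rw [← integral_indicator UHP_meas]
  congr 2
  ext x
  rw [Set.indicator_mul_left, ← integral_indicator UHP_meas]
  congr 2
  ext y
  rw [Set.indicator_mul_right]

theorem aux_shift (η : ℝ × ℝ → ℝ) (t : ℝ) :
    ∫ x, η (x - (0, t)) * ∫ y, greenG x y * η (y - (0, t))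
      = ∫ x, η x * ∫ y, auxG t x y * η y := by
  rw [← integral_sub_right_eq_self (fun x => η x * ∫ y, auxG t x y * η y) ((0, t) : ℝ × ℝ)]
  congr 1
  ext x
  rw [← integral_sub_right_eq_self (fun y => auxG t (x - (0, t)) y * η y) ((0, t) : ℝ × ℝ)]
  congr 2
  ext y
  simp [auxG, greenG, sqdist]

/-- Translating a nontrivial nonnegative vorticity upwards strictly increases
the kinetic energy. -/
theorem stmt_16 (p : ℝ) (hp : 2 < p) (ζ : ℝ × ℝ → ℝ)
    (hnn : ∀ x, 0 ≤ ζ x) (h1 : Integrable ζ μUH)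
    (hmem : MemLp ζ (ENNReal.ofReal p) μUH)
    (hne : ¬ (ζ =ᵐ[μUH] fun _ => (0 : ℝ)))
    (himpint : Integrable (fun y => ζ y * y.2) μUH)
    (τ : ℝ) (hτ : 0 < τ) :
    energy ζ < energy fun x => if τ < x.2 then ζ (x.1, x.2 - τ) else 0 := by
  set η := UHP.indicator ζ with hη
  have e2 : UHP.indicator (fun x : ℝ × ℝ => if τ < x.2 then ζ (x.1, x.2 - τ) else 0)
      = fun x => η (x - (0, τ)) := by
    ext ⟨a, b⟩
    simp only [hη, UHP, Set.indicator_apply, Set.mem_ofPred_eq, Prod.mk_sub_mk, sub_zero, sub_pos]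
    by_cases h : τ < b
    · simp [h, hτ.trans h]
    · simp [h]
  have e1 := aux_shift η 0
  rw [show ((0 : ℝ), (0 : ℝ)) = 0 from rfl] at e1
  simp only [sub_zero] at e1
  rw [aux_energy, aux_energy, e2, ← hη, aux_shift η τ, e1]
  have hsq : Integrable (fun x => ζ x ^ 2) μUH := by
    have hp0 : ENNReal.ofReal p ≠ 0 := by simp; linarith
    have hpw := hmem.integrable_norm_rpow hp0 ENNReal.ofReal_ne_top
    rw [ENNReal.toReal_ofReal (by linarith)] at hpw
    refine (h1.add hpw).mono' (h1.aestronglyMeasurable.pow 2) (Eventually.of_forall fun x => ?_)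
    simp only [Pi.add_apply]
    rw [Real.norm_of_nonneg (sq_nonneg _), Real.norm_of_nonneg (hnn x)]
    rcases le_total (ζ x) 1 with h | h
    · have : 0 ≤ ζ x ^ p := Real.rpow_nonneg (hnn x) _
      nlinarith [hnn x]
    · have : ζ x ^ (2:ℝ) ≤ ζ x ^ p := Real.rpow_le_rpow_of_exponent_le h hp.le
      rw [Real.rpow_two] at this
      linarith [hnn x]
  have k1 : Integrable η := (integrable_indicator_iff UHP_meas).2 h1
  have k2 : Integrable (fun x => η x ^ 2) := by
    have := (integrable_indicator_iff UHP_meas).2 hsq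
    refine this.congr (Eventually.of_forall fun x => ?_)
    by_cases h : x ∈ UHP <;> simp [hη, h]
  have k3 : Integrable (fun x => η x * x.2) := by
    have := (integrable_indicator_iff UHP_meas).2 himpint
    refine this.congr (Eventually.of_forall fun x => ?_)
    by_cases h : x ∈ UHP <;> simp [hη, h]
  have k4 : ¬ (∀ᵐ x, η x = 0) := by
    intro h
    apply hne
    unfold μUH
    rw [Filter.EventuallyEq, ae_restrict_iff' UHP_meas]
    filter_upwards [h] with x hx hU
    simpa [hη, hU] using hx
  have := aux_lt η (fun x => Set.indicator_nonneg (fun x _ => hnn x) x)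
    (fun x hx => Set.indicator_of_notMem (by simpa [UHP] using hx) _) k1 k2 k3 k4 τ hτ
  linarith
end
end

section
/- (Dichotomy interaction estimate) Let 2<p<∞ and let (ξₙ) and (ηₙ) be sequences of nonnegative functions in L¹(Π) ∩ L^p(Π) such that the sequences (‖ξₙ‖₁), (‖ηₙ‖₁), (‖ξₙ‖_p), (‖ηₙ‖_p), (I(ξₙ)) and (I(ηₙ)) are bounded, and such that ξₙ vanishes almost everywhere outside a measurable set Aₙ ⊂ Π, ηₙ vanishes almost everywhere outside a measurable set Bₙ ⊂ Π, and dist(Aₙ, Bₙ) → ∞ as n → ∞. Then ∫_Π ξₙ(x) Gηₙ(x) dx → 0 as n → ∞. -/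
open MeasureTheory Real Filter Topology

noncomputable section

lemma greenG_nonneg' {x y : ℝ × ℝ} (hx : 0 < x.2) (hy : 0 < y.2) : 0 ≤ greenG x y := by
  unfold greenG
  have h : 0 ≤ sqdist x y := by unfold sqdist; positivity
  have h2 : 0 ≤ 4 * x.2 * y.2 / sqdist x y := by positivity
  exact mul_nonneg (by positivity) (Real.log_nonneg (by linarith))

lemma greenG_le' {x y : ℝ × ℝ} (hx : 0 < x.2) (hy : 0 < y.2) {D : ℝ} (hD : 0 < D)
    (h : D ≤ euclDist x y) : greenG x y ≤ x.2 / D ^ 2 * y.2 := by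
  have hs0 : 0 ≤ sqdist x y := by unfold sqdist; positivity
  have hs : D ^ 2 ≤ sqdist x y := by
    unfold euclDist at h
    exact (Real.le_sqrt' hD).1 h
  have h2 : 0 ≤ 4 * x.2 * y.2 / sqdist x y := by positivity
  have h3 : Real.log (1 + 4 * x.2 * y.2 / sqdist x y) ≤ 4 * x.2 * y.2 / sqdist x y := by
    have := Real.log_le_sub_one_of_pos (x := 1 + 4 * x.2 * y.2 / sqdist x y) (by linarith)
    linarith
  have h4 : 4 * x.2 * y.2 / sqdist x y ≤ 4 * x.2 * y.2 / D ^ 2 := by gcongr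
  have h5 : (4 * π)⁻¹ ≤ (4 : ℝ)⁻¹ := by
    apply inv_anti₀ (by norm_num)
    linarith [Real.pi_gt_three]
  unfold greenG
  calc (4 * π)⁻¹ * Real.log (1 + 4 * x.2 * y.2 / sqdist x y)
      ≤ (4 : ℝ)⁻¹ * (4 * x.2 * y.2 / D ^ 2) :=
        mul_le_mul h5 (h3.trans h4) (Real.log_nonneg (by linarith)) (by norm_num)
    _ = x.2 / D ^ 2 * y.2 := by field_simp

lemma ae_UHP' : ∀ᵐ x ∂μUH, 0 < x.2 := by
  have : MeasurableSet UHP := measurableSet_lt measurable_const measurable_snd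
  exact ae_restrict_mem this

/-- Dichotomy interaction estimate: the cross energy term of two bounded
families supported on sets whose mutual distance tends to infinity tends to 0. -/
theorem stmt_19 (p : ℝ) (hp : 2 < p)
    (ξn ηn : ℕ → ℝ × ℝ → ℝ) (A B : ℕ → Set (ℝ × ℝ))
    (hξnn : ∀ n x, 0 ≤ ξn n x) (hηnn : ∀ n x, 0 ≤ ηn n x)
    (hξ1 : ∀ n, Integrable (ξn n) μUH) (hη1 : ∀ n, Integrable (ηn n) μUH)
    (hξp : ∀ n, MemLp (ξn n) (ENNReal.ofReal p) μUH)
    (hηp : ∀ n, MemLp (ηn n) (ENNReal.ofReal p) μUH)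
    (hξi : ∀ n, Integrable (fun y => ξn n y * y.2) μUH)
    (hηi : ∀ n, Integrable (fun y => ηn n y * y.2) μUH)
    (hbdd : ∃ C : ℝ, ∀ n,
      lpN 1 (ξn n) ≤ C ∧ lpN 1 (ηn n) ≤ C ∧ lpN p (ξn n) ≤ C ∧ lpN p (ηn n) ≤ C ∧
      impulse (ξn n) ≤ C ∧ impulse (ηn n) ≤ C)
    (hAmeas : ∀ n, MeasurableSet (A n)) (hBmeas : ∀ n, MeasurableSet (B n))
    (hAsub : ∀ n, A n ⊆ UHP) (hBsub : ∀ n, B n ⊆ UHP)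
    (hξA : ∀ n, ∀ᵐ x ∂μUH, x ∉ A n → ξn n x = 0)
    (hηB : ∀ n, ∀ᵐ x ∂μUH, x ∉ B n → ηn n x = 0)
    (hdist : ∀ D : ℝ, 0 < D → ∃ N : ℕ, ∀ n ≥ N, ∀ a ∈ A n, ∀ b ∈ B n,
      D ≤ euclDist a b) :
    Tendsto (fun n => ∫ x, ξn n x * Gop (ηn n) x ∂μUH) atTop (nhds 0) := by
  obtain ⟨C, hC⟩ := hbdd
  have hi0 : ∀ ζ : ℝ × ℝ → ℝ, (∀ x, 0 ≤ ζ x) → 0 ≤ impulse ζ := by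
    intro ζ hζ
    apply integral_nonneg_of_ae
    filter_upwards [ae_UHP'] with x hx
    exact mul_nonneg (hζ x) hx.le
  have hG0 : ∀ n x, 0 < x.2 → 0 ≤ Gop (ηn n) x := by
    intro n x hx
    apply integral_nonneg_of_ae
    filter_upwards [ae_UHP'] with y hy
    exact mul_nonneg (greenG_nonneg' hx hy) (hηnn n y)
  have hT0 : ∀ n, 0 ≤ ∫ x, ξn n x * Gop (ηn n) x ∂μUH := by
    intro n
    apply integral_nonneg_of_ae
    filter_upwards [ae_UHP'] with x hx
    exact mul_nonneg (hξnn n x) (hG0 n x hx)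
  rw [Metric.tendsto_atTop]
  intro ε hε
  have hD1 : 1 ≤ C * C / ε + 1 := by
    have : 0 ≤ C * C / ε := div_nonneg (mul_self_nonneg C) hε.le
    linarith
  set D : ℝ := C * C / ε + 1 with hDdef
  have hD : 0 < D := by linarith
  obtain ⟨N, hN⟩ := hdist D hD
  refine ⟨N, fun n hn => ?_⟩
  rw [Real.dist_eq, sub_zero, abs_of_nonneg (hT0 n)]
  have hGle : ∀ x ∈ A n, Gop (ηn n) x ≤ x.2 / D ^ 2 * impulse (ηn n) := by
    intro x hxA
    have hx : 0 < x.2 := hAsub n hxA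
    unfold Gop impulse
    rw [← integral_const_mul]
    apply integral_mono_of_nonneg
    · filter_upwards [ae_UHP'] with y hy
      exact mul_nonneg (greenG_nonneg' hx hy) (hηnn n y)
    · exact (hηi n).const_mul _
    · filter_upwards [hηB n] with y hyB
      by_cases hy : y ∈ B n
      · have := mul_le_mul_of_nonneg_right
          (greenG_le' hx (hBsub n hy) hD (hN n hn x hxA y hy)) (hηnn n y)
        calc _ ≤ _ := this
          _ = _ := by ring
      · simp [hyB hy]
  have hmain : ∫ x, ξn n x * Gop (ηn n) x ∂μUH
      ≤ impulse (ηn n) / D ^ 2 * impulse (ξn n) := by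
    conv_rhs => unfold impulse
    change _ ≤ impulse (ηn n) / D ^ 2 * _
    rw [← integral_const_mul]
    apply integral_mono_of_nonneg
    · filter_upwards [ae_UHP'] with x hx
      exact mul_nonneg (hξnn n x) (hG0 n x hx)
    · exact (hξi n).const_mul _
    · filter_upwards [hξA n] with x hxA
      by_cases hx : x ∈ A n
      · have := mul_le_mul_of_nonneg_left (hGle x hx) (hξnn n x)
        calc _ ≤ _ := this
          _ = _ := by ring
      · simp [hxA hx]
  obtain ⟨-, -, -, -, h1, h2⟩ := hC n
  have a1 := hi0 _ (hξnn n)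
  have a2 := hi0 _ (hηnn n)
  have hprod : impulse (ηn n) * impulse (ξn n) ≤ C * C := mul_le_mul h2 h1 a1 (a2.trans h2)
  have hCC : C * C < ε * D ^ 2 := by
    have e : ε * D = C * C + ε := by rw [hDdef]; field_simp
    nlinarith [mul_pos hε hD]
  calc _ ≤ _ := hmain
    _ = impulse (ηn n) * impulse (ξn n) / D ^ 2 := by ring
    _ < ε := by
      rw [div_lt_iff₀ (by positivity)]
      linarith
end
end
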